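/- Let X_1, X_2, … be i.i.d. real-valued random variables with common law P, and let μ_n be the law of the sample mean Ŝ_n = (1/n)∑_{i=1}^n X_i. Define γ(x) := inf{ D(Q‖P) : Q a probability measure on ℝ with ∫ y dQ(y) = x }. Then: (a) for every closed set F ⊆ ℝ, liminf_{n→∞} −(1/n) log μ_n(F) ≥ inf_{x∈F} γ(x); (b) for every open set G ⊆ ℝ, limsup_{n→∞} −(1/n) log μ_n(G) ≤ inf_{x∈G} γ(x). In particular, {μ_n} satisfies the large deviation principle with convex rate function γ. -/

import Mathlib

open MeasureTheory Filter Topology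
open scoped ENNReal NNReal Classical

/-- Relative entropy `D(Q‖P)`: `∫ log (dQ/dP) dQ` if `Q ≪ P` (and the integral is
well-defined), `+∞` otherwise. -/
noncomputable def relEnt {X : Type*} [MeasurableSpace X] (Q P : Measure X) : ℝ≥0∞ :=
  if Q ≪ P ∧ Integrable (llr Q P) Q then ENNReal.ofReal (∫ x, llr Q P x ∂Q) else ⊤

/-- `-(1/n) log p`, as an extended real number. -/
noncomputable def negLogRate (n : ℕ) (p : ℝ≥0∞) : EReal :=
  (-(((n : ℝ)⁻¹ : ℝ) : EReal)) * ENNReal.log p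

/-- The Cramér rate function `γ(x) = inf { D(Q‖P) : E_Q[X] = x }`. -/
noncomputable def cramerRate (P : Measure ℝ) (x : ℝ) : ℝ≥0∞ :=
  ⨅ (Q : Measure ℝ) (_ : IsProbabilityMeasure Q) (_ : Integrable (fun y => y) Q)
    (_ : ∫ y, y ∂Q = x), relEnt Q P

/-- The law `μ_n` of the sample mean of `n` i.i.d. samples from `P`. -/
noncomputable def sampleMeanLaw (P : Measure ℝ) (n : ℕ) : Measure ℝ :=
  Measure.map (fun x : Fin n → ℝ => (∑ i, x i) / n) (Measure.pi fun _ : Fin n => P)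

section Convexity

variable {X : Type*} [MeasurableSpace X]

lemma relEnt_eq_klDiv (Q P : Measure X) [IsProbabilityMeasure Q] [IsProbabilityMeasure P] :
    relEnt Q P = InformationTheory.klDiv Q P := by
  rw [relEnt, InformationTheory.klDiv_def]
  simp

lemma isProbabilityMeasure_convexComb (Q₁ Q₂ : Measure X) [IsProbabilityMeasure Q₁]
    [IsProbabilityMeasure Q₂] {s t : ℝ≥0} (hst : s + t = 1) :
    IsProbabilityMeasure (s • Q₁ + t • Q₂) := ⟨by
  change (s : ℝ≥0∞) * Q₁ Set.univ + t * Q₂ Set.univ = 1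
  rw [measure_univ, measure_univ, mul_one, mul_one]
  exact_mod_cast hst⟩

lemma relEnt_convexComb_le (Q₁ Q₂ P : Measure X) [IsProbabilityMeasure Q₁]
    [IsProbabilityMeasure Q₂] [IsProbabilityMeasure P] {s t : ℝ≥0} (hs : s ≠ 0) (ht : t ≠ 0)
    (hst : s + t = 1) :
    relEnt (s • Q₁ + t • Q₂) P ≤ s * relEnt Q₁ P + t * relEnt Q₂ P := by
  have hprob := isProbabilityMeasure_convexComb Q₁ Q₂ hst
  rw [relEnt_eq_klDiv, relEnt_eq_klDiv, relEnt_eq_klDiv]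
  by_cases h₁ : Q₁ ≪ P
  swap
  · simp [InformationTheory.klDiv_of_not_ac h₁, ENNReal.mul_top, hs]
  by_cases h₂ : Q₂ ≪ P
  swap
  · simp [InformationTheory.klDiv_of_not_ac h₂, ENNReal.mul_top, ht]
  have h₃ : s • Q₁ + t • Q₂ ≪ P := (h₁.smul_left s).add_left (h₂.smul_left t)
  rw [InformationTheory.klDiv_eq_lintegral_klFun_of_ac h₁,
    InformationTheory.klDiv_eq_lintegral_klFun_of_ac h₂,
    InformationTheory.klDiv_eq_lintegral_klFun_of_ac h₃,
    ← lintegral_const_mul _ (by fun_prop), ← lintegral_const_mul _ (by fun_prop),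
    ← lintegral_add_left (by fun_prop)]
  refine lintegral_mono_ae ?_
  filter_upwards [Measure.rnDeriv_add (s • Q₁) (t • Q₂) P, Measure.rnDeriv_smul_left Q₁ P s,
    Measure.rnDeriv_smul_left Q₂ P t, Q₁.rnDeriv_ne_top P, Q₂.rnDeriv_ne_top P]
    with x hadd hsm₁ hsm₂ hx₁ hx₂
  have hval : ((s • Q₁ + t • Q₂).rnDeriv P x).toReal
      = (s : ℝ) * (Q₁.rnDeriv P x).toReal + (t : ℝ) * (Q₂.rnDeriv P x).toReal := by
    rw [hadd, Pi.add_apply, hsm₁, hsm₂, Pi.smul_apply, Pi.smul_apply, ENNReal.smul_def,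
      ENNReal.smul_def, smul_eq_mul, smul_eq_mul, ENNReal.toReal_add
        (ENNReal.mul_ne_top ENNReal.coe_ne_top hx₁) (ENNReal.mul_ne_top ENNReal.coe_ne_top hx₂)]
    simp
  have hconv := InformationTheory.convexOn_klFun.2
    (x := (Q₁.rnDeriv P x).toReal) (y := (Q₂.rnDeriv P x).toReal)
    ENNReal.toReal_nonneg ENNReal.toReal_nonneg
    s.coe_nonneg t.coe_nonneg (by exact_mod_cast hst)
  simp only [smul_eq_mul] at hconv
  rw [hval]
  refine (ENNReal.ofReal_le_ofReal hconv).trans (ENNReal.ofReal_add_le.trans ?_)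
  rw [ENNReal.ofReal_mul s.coe_nonneg, ENNReal.ofReal_mul t.coe_nonneg,
    ENNReal.ofReal_coe_nnreal, ENNReal.ofReal_coe_nnreal]

end Convexity

lemma cramerRate_le {P Q : Measure ℝ} (hQ : IsProbabilityMeasure Q)
    (hint : Integrable (fun y => y) Q) : cramerRate P (∫ y, y ∂Q) ≤ relEnt Q P :=
  iInf_le_of_le Q <| iInf_le_of_le hQ <| iInf_le_of_le hint <| iInf_le _ rfl

lemma exists_relEnt_lt {P : Measure ℝ} {x : ℝ} {a : ℝ≥0∞} (h : cramerRate P x < a) :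
    ∃ Q : Measure ℝ, IsProbabilityMeasure Q ∧ Integrable (fun y => y) Q ∧ ∫ y, y ∂Q = x
      ∧ relEnt Q P < a := by
  simpa only [cramerRate, iInf_lt_iff, exists_prop] using h

lemma cramerRate_convexComb_le (P : Measure ℝ) [IsProbabilityMeasure P] (x y : ℝ) {s t : ℝ≥0}
    (hst : s + t = 1) :
    cramerRate P (s * x + t * y) ≤ s * cramerRate P x + t * cramerRate P y := by
  rcases eq_or_ne s 0 with rfl | hs
  · obtain rfl : t = 1 := by simpa using hst
    simp
  rcases eq_or_ne t 0 with rfl | ht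
  · obtain rfl : s = 1 := by simpa using hst
    simp
  by_cases hx : cramerRate P x = ⊤
  · simp [hx, ENNReal.mul_top, hs]
  by_cases hy : cramerRate P y = ⊤
  · simp [hy, ENNReal.mul_top, ht]
  refine ENNReal.le_of_forall_pos_le_add fun ε hε _ => ?_
  have hε' : (ε : ℝ≥0∞) ≠ 0 := by exact_mod_cast hε.ne'
  obtain ⟨Q₁, hQ₁, hi₁, rfl, hlt₁⟩ := exists_relEnt_lt (ENNReal.lt_add_right hx hε')
  obtain ⟨Q₂, hQ₂, hi₂, rfl, hlt₂⟩ := exists_relEnt_lt (ENNReal.lt_add_right hy hε')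
  have hst' : (s : ℝ≥0∞) + t = 1 := by exact_mod_cast hst
  have hprob := isProbabilityMeasure_convexComb Q₁ Q₂ hst
  have hi₁' : Integrable (fun y => y) (s • Q₁) := hi₁.smul_measure_nnreal
  have hi₂' : Integrable (fun y => y) (t • Q₂) := hi₂.smul_measure_nnreal
  have hmean : ∫ y, y ∂(s • Q₁ + t • Q₂) = s * ∫ y, y ∂Q₁ + t * ∫ y, y ∂Q₂ := by
    rw [integral_add_measure hi₁' hi₂', integral_smul_nnreal_measure,
      integral_smul_nnreal_measure]
    rfl
  rw [← hmean]
  refine (cramerRate_le hprob (hi₁'.add_measure hi₂')).trans <|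
    (relEnt_convexComb_le Q₁ Q₂ P hs ht hst).trans ?_
  calc (s : ℝ≥0∞) * relEnt Q₁ P + t * relEnt Q₂ P
      ≤ s * (cramerRate P (∫ y, y ∂Q₁) + ε) + t * (cramerRate P (∫ y, y ∂Q₂) + ε) := by gcongr
    _ = s * cramerRate P (∫ y, y ∂Q₁) + t * cramerRate P (∫ y, y ∂Q₂) + (s + t) * ε := by ring
    _ = _ := by rw [hst', one_mul]

section MeanMarginal

variable {X : Type*} [MeasurableSpace X] {n : ℕ}

/-- The average of the one-dimensional marginals of a measure on `Fin n → X`. -/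
noncomputable def meanMarginal (ν : Measure (Fin n → X)) : Measure X :=
  ((n : ℝ≥0)⁻¹) • ∑ i, ν.map (fun x => x i)

lemma meanMarginal_apply (ν : Measure (Fin n → X)) {s : Set X} (hs : MeasurableSet s) :
    meanMarginal ν s = ((n : ℝ≥0)⁻¹ : ℝ≥0) * ∑ i, ν ((fun x => x i) ⁻¹' s) := by
  simp only [meanMarginal, Measure.smul_apply, Measure.finsetSum_apply]
  rw [ENNReal.smul_def, smul_eq_mul]
  congr 1
  exact Finset.sum_congr rfl fun i _ => Measure.map_apply (measurable_pi_apply i) hs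

lemma coe_inv_natCast_mul_natCast (hn : n ≠ 0) :
    (((n : ℝ≥0)⁻¹ : ℝ≥0) : ℝ≥0∞) * (n : ℝ≥0∞) = 1 := by
  have : (n : ℝ≥0)⁻¹ * n = 1 := inv_mul_cancel₀ (by exact_mod_cast hn)
  exact_mod_cast this

lemma isProbabilityMeasure_meanMarginal (hn : n ≠ 0) (ν : Measure (Fin n → X))
    [IsProbabilityMeasure ν] : IsProbabilityMeasure (meanMarginal ν) := ⟨by
  rw [meanMarginal_apply ν MeasurableSet.univ]
  simpa using coe_inv_natCast_mul_natCast hn⟩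

lemma integrable_meanMarginal {ν : Measure (Fin n → X)} {f : X → ℝ} (hf : Measurable f)
    (hint : ∀ i, Integrable (fun x => f (x i)) ν) : Integrable f (meanMarginal ν) := by
  refine Integrable.smul_measure_nnreal ?_
  rw [integrable_finsetSum_measure]
  exact fun i _ => (integrable_map_measure hf.aestronglyMeasurable
    (measurable_pi_apply i).aemeasurable).2 (hint i)

lemma integral_meanMarginal {ν : Measure (Fin n → X)} {f : X → ℝ} (hf : Measurable f)
    (hint : ∀ i, Integrable (fun x => f (x i)) ν) :
    ∫ y, f y ∂(meanMarginal ν) = (n : ℝ)⁻¹ * ∫ x, ∑ i, f (x i) ∂ν := by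
  rw [meanMarginal, integral_smul_nnreal_measure, integral_finsetSum_measure,
    integral_finsetSum _ fun i _ => hint i]
  · simp only [NNReal.smul_def, smul_eq_mul, NNReal.coe_inv, NNReal.coe_natCast]
    congr 1
    exact Finset.sum_congr rfl fun i _ => integral_map (measurable_pi_apply i).aemeasurable
      hf.aestronglyMeasurable
  · exact fun i _ => (integrable_map_measure hf.aestronglyMeasurable
      (measurable_pi_apply i).aemeasurable).2 (hint i)

variable (P : Measure X) [IsProbabilityMeasure P] {B : Set (Fin n → X)}

lemma smul_meanMarginal_cond_le (hn : n ≠ 0) (hB : MeasurableSet B)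
    (hB₀ : Measure.pi (fun _ : Fin n => P) B ≠ 0) :
    Measure.pi (fun _ : Fin n => P) B •
      meanMarginal (ProbabilityTheory.cond (Measure.pi fun _ : Fin n => P) B) ≤ P := by
  set π := Measure.pi (fun _ : Fin n => P) with hπ
  refine Measure.le_iff.2 fun s hs => ?_
  have hi (i : Fin n) : π B * ProbabilityTheory.cond π B ((fun x => x i) ⁻¹' s) ≤ P s := by
    rw [ProbabilityTheory.cond_apply hB, ← mul_assoc,
      ENNReal.mul_inv_cancel hB₀ (measure_ne_top _ _), one_mul]
    refine (measure_mono Set.inter_subset_right).trans_eq ?_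
    exact (measurePreserving_eval (fun _ : Fin n => P) i).measure_preimage hs.nullMeasurableSet
  rw [Measure.smul_apply, meanMarginal_apply _ hs, smul_eq_mul, mul_left_comm, Finset.mul_sum]
  calc _ ≤ (((n : ℝ≥0)⁻¹ : ℝ≥0) : ℝ≥0∞) * ∑ _i : Fin n, P s := by
        gcongr with i
        exact hi i
    _ = P s := by
        rw [Finset.sum_const, Finset.card_univ, Fintype.card_fin, nsmul_eq_mul, ← mul_assoc,
          coe_inv_natCast_mul_natCast hn, one_mul]

/-- The Donsker–Varadhan inequality for a product measure conditioned on an event. -/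
lemma measureReal_mul_exp_integral_meanMarginal_le (hn : n ≠ 0)
    (hB₀ : Measure.pi (fun _ : Fin n => P) B ≠ 0) {f : X → ℝ} (hf : Measurable f) {K : ℝ}
    (hK : ∀ x, |f x| ≤ K) :
    (Measure.pi fun _ : Fin n => P).real B * Real.exp (n *
      ∫ y, f y ∂(meanMarginal (ProbabilityTheory.cond (Measure.pi fun _ : Fin n => P) B)))
      ≤ (∫ x, Real.exp (f x) ∂P) ^ n := by
  set π := Measure.pi (fun _ : Fin n => P) with hπ
  set ν := ProbabilityTheory.cond π B with hν
  have : IsProbabilityMeasure ν := ProbabilityTheory.cond_isProbabilityMeasure hB₀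
  have hfi (i : Fin n) : Integrable (fun x => f (x i)) ν :=
    Integrable.of_bound (hf.comp (measurable_pi_apply i)).aestronglyMeasurable K
      (Eventually.of_forall fun x => hK _)
  have hsum : Integrable (fun x => ∑ i, f (x i)) ν := integrable_finsetSum _ fun i _ => hfi i
  have hexp (μ : Measure (Fin n → X)) [IsFiniteMeasure μ] :
      Integrable (fun x => Real.exp (∑ i, f (x i))) μ := by
    refine Integrable.of_bound (Measurable.aestronglyMeasurable (by fun_prop)) (Real.exp (n * K))
      (Eventually.of_forall fun x => ?_)
    rw [Real.norm_eq_abs, Real.abs_exp, Real.exp_le_exp]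
    calc ∑ i, f (x i) ≤ ∑ _i : Fin n, K := Finset.sum_le_sum fun i _ => (le_abs_self _).trans (hK _)
      _ = n * K := by simp
  rw [integral_meanMarginal hf hfi, mul_inv_cancel_left₀ (by exact_mod_cast hn)]
  set a := ∫ x, ∑ i, f (x i) ∂ν with ha
  have hsub : Integrable (fun x => ∑ i, f (x i) - a) ν := hsum.sub (integrable_const a)
  have h₁ : Real.exp a ≤ ∫ x, Real.exp (∑ i, f (x i)) ∂ν := by
    have : ∫ x, Real.exp a * (∑ i, f (x i) - a + 1) ∂ν = Real.exp a := by
      rw [integral_const_mul, integral_add hsub (integrable_const _),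
        integral_sub hsum (integrable_const _), ← ha]
      simp
    rw [← this]
    refine integral_mono ((hsub.add (integrable_const _)).const_mul _)
      (hexp ν) fun x => ?_
    calc Real.exp a * (∑ i, f (x i) - a + 1) ≤ Real.exp a * Real.exp (∑ i, f (x i) - a) := by
          gcongr
          exact Real.add_one_le_exp _
      _ = Real.exp (∑ i, f (x i)) := by rw [← Real.exp_add, add_sub_cancel]
  have h₂ : π.real B * ∫ x, Real.exp (∑ i, f (x i)) ∂ν = ∫ x in B, Real.exp (∑ i, f (x i)) ∂π := by
    rw [hν, ProbabilityTheory.cond, integral_smul_measure, ENNReal.toReal_inv, smul_eq_mul,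
      ← mul_assoc, measureReal_def,
      mul_inv_cancel₀ (ENNReal.toReal_ne_zero.2 ⟨hB₀, measure_ne_top _ _⟩), one_mul]
  calc π.real B * Real.exp a ≤ π.real B * ∫ x, Real.exp (∑ i, f (x i)) ∂ν := by gcongr
    _ = ∫ x in B, Real.exp (∑ i, f (x i)) ∂π := h₂
    _ ≤ ∫ x, Real.exp (∑ i, f (x i)) ∂π :=
        setIntegral_le_integral (hexp π) (Eventually.of_forall fun x => (Real.exp_pos _).le)
    _ = (∫ x, Real.exp (f x) ∂P) ^ n := by
        simp_rw [Real.exp_sum]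
        rw [hπ, integral_fintype_prod_eq_pow (fun x => Real.exp (f x)), Fintype.card_fin]

/-- An event of a product measure has probability at most `exp (-n D(Q‖P))`, where `Q` is the
average marginal of the conditional law given the event. -/
lemma exists_relEnt_meanMarginal_cond (hn : n ≠ 0) (hB : MeasurableSet B)
    (hB₀ : Measure.pi (fun _ : Fin n => P) B ≠ 0) :
    ∃ D : ℝ, relEnt (meanMarginal (ProbabilityTheory.cond (Measure.pi fun _ : Fin n => P) B)) P
        = ENNReal.ofReal D ∧
      (Measure.pi fun _ : Fin n => P).real B ≤ Real.exp (-(n * D)) := by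
  set π := Measure.pi (fun _ : Fin n => P) with hπ
  set Q := meanMarginal (ProbabilityTheory.cond π B) with hQ
  have : IsProbabilityMeasure (ProbabilityTheory.cond π B) :=
    ProbabilityTheory.cond_isProbabilityMeasure hB₀
  have hQprob : IsProbabilityMeasure Q := isProbabilityMeasure_meanMarginal hn _
  have hle : π B • Q ≤ P := smul_meanMarginal_cond_le P hn hB hB₀
  have hac : Q ≪ P :=
    (Measure.absolutelyContinuous_smul hB₀).trans hle.absolutelyContinuous
  have hp : 0 < π.real B := ENNReal.toReal_pos hB₀ (measure_ne_top _ _)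
  set C := 1 / π.real B with hC
  have hC₀ : 0 < C := one_div_pos.2 hp
  set g : X → ℝ := fun x => (Q.rnDeriv P x).toReal with hg
  have hgm : Measurable g := (Measure.measurable_rnDeriv Q P).ennreal_toReal
  have hg₀ (x : X) : 0 ≤ g x := ENNReal.toReal_nonneg
  have hgC : ∀ᵐ x ∂P, g x ≤ C := by
    filter_upwards [Measure.rnDeriv_le_one_of_le hle,
      Measure.rnDeriv_smul_left_of_ne_top Q P (measure_ne_top π B)] with x h₁ h₂
    rw [h₂, Pi.smul_apply, smul_eq_mul, Pi.one_apply] at h₁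
    have h₃ := ENNReal.toReal_mono ENNReal.one_ne_top h₁
    rw [ENNReal.toReal_mul, ENNReal.toReal_one] at h₃
    exact (le_div_iff₀' hp).2 h₃
  have hint : Integrable (llr Q P) Q := by
    rw [← integrable_rnDeriv_mul_log_iff hac]
    obtain ⟨K, hK⟩ := isCompact_Icc.exists_bound_of_continuousOn
      (Real.continuous_mul_log.continuousOn (s := Set.Icc 0 C))
    refine Integrable.of_bound (hgm.mul hgm.log).aestronglyMeasurable K ?_
    filter_upwards [hgC] with x hx using hK _ ⟨hg₀ x, hx⟩
  refine ⟨∫ x, llr Q P x ∂Q, if_pos ⟨hac, hint⟩, ?_⟩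
  set D := ∫ x, llr Q P x ∂Q with hD
  have hg_int : Integrable g P := Measure.integrable_toReal_rnDeriv
  have hg_one : ∫ x, g x ∂P = 1 := by
    rw [hg, Measure.integral_toReal_rnDeriv hac]
    simp
  have key (ε : ℝ) (hε : 0 < ε) : π.real B * Real.exp (n * D) ≤ (1 + ε) ^ n := by
    set f : X → ℝ := fun x => Real.log (min (g x) C + ε) with hf
    have hfm : Measurable f := ((hgm.min measurable_const).add_const ε).log
    have hpos (x : X) : ε ≤ min (g x) C + ε := by
      have := le_min (hg₀ x) hC₀.le
      linarith
    have hfK (x : X) : |f x| ≤ max |Real.log ε| |Real.log (C + ε)| := by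
      refine abs_le_max_abs_abs (Real.log_le_log hε (hpos x))
        (Real.log_le_log (hε.trans_le (hpos x)) ?_)
      gcongr
      exact min_le_right _ _
    have hDf : D ≤ ∫ y, f y ∂Q := by
      refine integral_mono_ae hint (Integrable.of_bound hfm.aestronglyMeasurable _
        (Eventually.of_forall hfK)) ?_
      filter_upwards [hac.ae_le hgC, Measure.rnDeriv_pos hac,
        hac.ae_le (Measure.rnDeriv_lt_top Q P)] with x h₁ h₂ h₃
      refine Real.log_le_log (ENNReal.toReal_pos h₂.ne' h₃.ne) ?_
      rw [min_eq_left h₁]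
      exact le_add_of_nonneg_right hε.le
    have hexp : ∫ x, Real.exp (f x) ∂P ≤ 1 + ε := by
      have : ∫ x, (g x + ε) ∂P = 1 + ε := by
        rw [integral_add hg_int (integrable_const _), hg_one]
        simp
      rw [← this]
      refine integral_mono_of_nonneg (Eventually.of_forall fun x => (Real.exp_pos _).le)
        (hg_int.add (integrable_const _)) (Eventually.of_forall fun x => ?_)
      simp only [hf]
      rw [Real.exp_log (hε.trans_le (hpos x))]
      gcongr
      exact min_le_left _ _
    calc π.real B * Real.exp (n * D) ≤ π.real B * Real.exp (n * ∫ y, f y ∂Q) := by gcongr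
      _ ≤ (∫ x, Real.exp (f x) ∂P) ^ n :=
          measureReal_mul_exp_integral_meanMarginal_le P hn hB₀ hfm hfK
      _ ≤ (1 + ε) ^ n := by
          gcongr
  have hlim : Tendsto (fun ε : ℝ => (1 + ε) ^ n) (𝓝[>] 0) (𝓝 1) := by
    have : Tendsto (fun ε : ℝ => (1 + ε) ^ n) (𝓝 0) (𝓝 ((1 + 0) ^ n)) :=
      Continuous.tendsto (by fun_prop) 0
    rw [add_zero, one_pow] at this
    exact this.mono_left nhdsWithin_le_nhds
  have hone : π.real B * Real.exp (n * D) ≤ 1 :=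
    ge_of_tendsto hlim (eventually_mem_nhdsWithin.mono key)
  rw [Real.exp_neg]
  rw [← one_div]
  exact (le_div_iff₀ (Real.exp_pos _)).2 hone

end MeanMarginal
lemma measurable_sampleMean (n : ℕ) : Measurable (fun x : Fin n → ℝ => (∑ i, x i) / n) := by
  fun_prop

lemma isProbabilityMeasure_sampleMeanLaw (P : Measure ℝ) [IsProbabilityMeasure P] (n : ℕ) :
    IsProbabilityMeasure (sampleMeanLaw P n) :=
  Measure.isProbabilityMeasure_map (measurable_sampleMean n).aemeasurable

lemma sampleMeanLaw_le_exp_of_convex (P : Measure ℝ) [IsProbabilityMeasure P] {n : ℕ} (hn : n ≠ 0)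
    {A : Set ℝ} (hA : IsClosed A) (hconv : Convex ℝ A) {r : ℝ}
    (hr : ∀ x ∈ A, ENNReal.ofReal r ≤ cramerRate P x) :
    sampleMeanLaw P n A ≤ ENNReal.ofReal (Real.exp (-(n * r))) := by
  have := isProbabilityMeasure_sampleMeanLaw P n
  rcases le_or_gt r 0 with hr₀ | hr₀
  · refine prob_le_one.trans ?_
    rw [← ENNReal.ofReal_one]
    refine ENNReal.ofReal_le_ofReal (Real.one_le_exp ?_)
    exact neg_nonneg.2 (mul_nonpos_of_nonneg_of_nonpos n.cast_nonneg hr₀)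
  set π := Measure.pi (fun _ : Fin n => P) with hπ
  set E : Set (Fin n → ℝ) := (fun x => (∑ i, x i) / n) ⁻¹' A with hE
  set B : ℕ → Set (Fin n → ℝ) := fun M => E ∩ {x | ∀ i, |x i| ≤ M} with hBdef
  have hEm : MeasurableSet E := measurable_sampleMean n hA.measurableSet
  have hBm (M : ℕ) : MeasurableSet (B M) := by
    refine hEm.inter ?_
    rw [Set.ofPred_forall]
    exact MeasurableSet.iInter fun i =>
      measurableSet_le (measurable_pi_apply i).abs measurable_const
  have hBmono : Monotone B := fun M N h x hx =>
    ⟨hx.1, fun i => (hx.2 i).trans (by exact_mod_cast h)⟩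
  have hBU : ⋃ M, B M = E := by
    refine Set.Subset.antisymm (Set.iUnion_subset fun M => Set.inter_subset_left) fun x hx => ?_
    obtain ⟨M, hM⟩ := exists_nat_ge (∑ i, |x i|)
    exact Set.mem_iUnion.2 ⟨M, hx, fun i =>
      (Finset.single_le_sum (fun j _ => abs_nonneg (x j)) (Finset.mem_univ i)).trans hM⟩
  rw [sampleMeanLaw, Measure.map_apply (measurable_sampleMean n) hA.measurableSet, ← hπ, ← hE,
    ← hBU, hBmono.measure_iUnion]
  refine iSup_le fun M => ?_
  rcases eq_or_ne (π (B M)) 0 with h₀ | h₀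
  · simp [h₀]
  obtain ⟨D, hD, hle⟩ := exists_relEnt_meanMarginal_cond P hn (hBm M) h₀
  rw [← hπ] at hD hle
  set ν := ProbabilityTheory.cond π (B M) with hν
  have hνp : IsProbabilityMeasure ν := ProbabilityTheory.cond_isProbabilityMeasure h₀
  have hmem : ∀ᵐ x ∂ν, x ∈ B M := ProbabilityTheory.ae_cond_mem (hBm M)
  have hint (i : Fin n) : Integrable (fun x => x i) ν :=
    Integrable.of_bound (measurable_pi_apply i).aestronglyMeasurable M
      (hmem.mono fun x hx => hx.2 i)
  have hmean : ∫ y, y ∂(meanMarginal ν) ∈ A := by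
    rw [integral_meanMarginal (f := fun y => y) measurable_id hint, ← integral_const_mul]
    refine hconv.integral_mem hA (hmem.mono fun x hx => ?_)
      ((integrable_finsetSum _ fun i _ => hint i).const_mul _)
    have : (∑ i, x i) / n ∈ A := hx.1
    rwa [div_eq_inv_mul] at this
  have hrD : ENNReal.ofReal r ≤ ENNReal.ofReal D := by
    rw [← hD]
    exact (hr _ hmean).trans (cramerRate_le (isProbabilityMeasure_meanMarginal hn ν)
      (integrable_meanMarginal measurable_id hint))
  rw [ENNReal.ofReal_le_ofReal_iff'] at hrD
  have hrD' : r ≤ D := hrD.resolve_right hr₀.not_ge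
  rw [← ofReal_measureReal]
  refine ENNReal.ofReal_le_ofReal (hle.trans ?_)
  gcongr

lemma cramerRate_lt_of_mem_segment {P : Measure ℝ} [IsProbabilityMeasure P] {c : ℝ≥0∞} {x y z : ℝ}
    (hx : cramerRate P x < c) (hy : cramerRate P y < c) (hz : z ∈ segment ℝ x y) :
    cramerRate P z < c := by
  obtain ⟨a, b, ha, hb, hab, rfl⟩ := hz
  lift a to ℝ≥0 using ha
  lift b to ℝ≥0 using hb
  have hab' : a + b = 1 := by exact_mod_cast hab
  refine (cramerRate_convexComb_le P x y hab').trans_lt ?_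
  calc (a : ℝ≥0∞) * cramerRate P x + b * cramerRate P y
      ≤ a * max (cramerRate P x) (cramerRate P y) + b * max (cramerRate P x) (cramerRate P y) := by
        gcongr
        · exact le_max_left _ _
        · exact le_max_right _ _
    _ = max (cramerRate P x) (cramerRate P y) := by
        rw [← add_mul, ← ENNReal.coe_add, hab', ENNReal.coe_one, one_mul]
    _ < c := max_lt hx hy

lemma exists_convex_cover {P : Measure ℝ} [IsProbabilityMeasure P] {F : Set ℝ} (hF : IsClosed F)
    {c : ℝ≥0∞} (hc : ∀ x ∈ F, c ≤ cramerRate P x) :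
    ∃ L R : Set ℝ, (IsClosed L ∧ Convex ℝ L ∧ ∀ x ∈ L, c ≤ cramerRate P x) ∧
      (IsClosed R ∧ Convex ℝ R ∧ ∀ x ∈ R, c ≤ cramerRate P x) ∧ F ⊆ L ∪ R := by
  by_cases hJ : ∃ j, cramerRate P j < c
  swap
  · push Not at hJ
    exact ⟨Set.univ, Set.univ, ⟨isClosed_univ, convex_univ, fun x _ => hJ x⟩,
      ⟨isClosed_univ, convex_univ, fun x _ => hJ x⟩, by simp⟩
  obtain ⟨j, hj⟩ := hJ
  have hleft : ∃ L : Set ℝ, (IsClosed L ∧ Convex ℝ L ∧ ∀ x ∈ L, c ≤ cramerRate P x) ∧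
      F ∩ Set.Iic j ⊆ L := by
    rcases (F ∩ Set.Iic j).eq_empty_or_nonempty with h | h
    · exact ⟨∅, ⟨isClosed_empty, convex_empty, by simp⟩, h.subset⟩
    have hbdd : BddAbove (F ∩ Set.Iic j) := ⟨j, fun x hx => hx.2⟩
    have hmem := (hF.inter isClosed_Iic).csSup_mem h hbdd
    refine ⟨Set.Iic (sSup (F ∩ Set.Iic j)), ⟨isClosed_Iic, convex_Iic _, fun x hx => ?_⟩,
      fun x hx => le_csSup hbdd hx⟩
    by_contra! hlt
    refine (hc _ hmem.1).not_gt (cramerRate_lt_of_mem_segment hlt hj ?_)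
    rw [segment_eq_Icc (le_trans hx hmem.2)]
    exact ⟨hx, hmem.2⟩
  have hright : ∃ R : Set ℝ, (IsClosed R ∧ Convex ℝ R ∧ ∀ x ∈ R, c ≤ cramerRate P x) ∧
      F ∩ Set.Ici j ⊆ R := by
    rcases (F ∩ Set.Ici j).eq_empty_or_nonempty with h | h
    · exact ⟨∅, ⟨isClosed_empty, convex_empty, by simp⟩, h.subset⟩
    have hbdd : BddBelow (F ∩ Set.Ici j) := ⟨j, fun x hx => hx.2⟩
    have hmem := (hF.inter isClosed_Ici).csInf_mem h hbdd
    refine ⟨Set.Ici (sInf (F ∩ Set.Ici j)), ⟨isClosed_Ici, convex_Ici _, fun x hx => ?_⟩,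
      fun x hx => csInf_le hbdd hx⟩
    by_contra! hlt
    refine (hc _ hmem.1).not_gt (cramerRate_lt_of_mem_segment hj hlt ?_)
    rw [segment_eq_Icc (le_trans hmem.2 hx)]
    exact ⟨hmem.2, hx⟩
  obtain ⟨L, hL, hFL⟩ := hleft
  obtain ⟨R, hR, hFR⟩ := hright
  refine ⟨L, R, hL, hR, fun x hx => ?_⟩
  rcases le_total x j with h | h
  · exact Or.inl (hFL ⟨hx, h⟩)
  · exact Or.inr (hFR ⟨hx, h⟩)

section ChangeOfMeasure

variable {X : Type*} [MeasurableSpace X] {P Q : Measure X} [IsProbabilityMeasure P]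
  [IsProbabilityMeasure Q]

lemma pi_eq_withDensity_prod_rnDeriv (hQP : Q ≪ P) (n : ℕ) :
    Measure.pi (fun _ : Fin n => Q)
      = (Measure.pi fun _ : Fin n => P).withDensity fun x => ∏ i, Q.rnDeriv P (x i) := by
  refine Measure.pi_eq fun s hs => ?_
  have hg (i : Fin n) : Measurable ((s i).indicator (Q.rnDeriv P)) :=
    (Measure.measurable_rnDeriv Q P).indicator (hs i)
  rw [withDensity_apply _ (MeasurableSet.univ_pi hs),
    ← lintegral_indicator (MeasurableSet.univ_pi hs)]
  have hind (x : Fin n → X) : (Set.univ.pi s).indicator (fun x => ∏ i, Q.rnDeriv P (x i)) x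
      = ∏ i, (s i).indicator (Q.rnDeriv P) (x i) := by
    by_cases hx : x ∈ Set.univ.pi s
    · rw [Set.indicator_of_mem hx]
      exact Finset.prod_congr rfl fun i _ => (Set.indicator_of_mem (hx i trivial) _).symm
    · rw [Set.indicator_of_notMem hx]
      obtain ⟨i, hi⟩ : ∃ i, x i ∉ s i := by simpa using hx
      exact (Finset.prod_eq_zero (Finset.mem_univ i) (Set.indicator_of_notMem hi _)).symm
  simp_rw [hind]
  rw [ProbabilityTheory.lintegral_prod_eq_prod_lintegral_of_indepFun Finset.univ
    (fun i (x : Fin n → X) => (s i).indicator (Q.rnDeriv P) (x i))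
    (ProbabilityTheory.iIndepFun_pi fun i => (hg i).aemeasurable)
    fun i => (hg i).comp (measurable_pi_apply i)]
  refine Finset.prod_congr rfl fun i _ => ?_
  rw [(measurePreserving_eval (fun _ : Fin n => P) i).lintegral_comp (hg i),
    lintegral_indicator (hs i), Measure.setLIntegral_rnDeriv hQP]

lemma pi_le_mul_pi_of_prod_rnDeriv_le (hQP : Q ≪ P) {n : ℕ} {E : Set (Fin n → X)}
    (hE : MeasurableSet E) {C : ℝ≥0∞} (hC : ∀ x ∈ E, ∏ i, Q.rnDeriv P (x i) ≤ C) :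
    Measure.pi (fun _ : Fin n => Q) E ≤ C * Measure.pi (fun _ : Fin n => P) E := by
  rw [pi_eq_withDensity_prod_rnDeriv hQP, withDensity_apply _ hE, ← setLIntegral_const]
  exact setLIntegral_mono' hE hC

lemma ae_tendsto_average_infinitePi {f : X → ℝ} (hfm : Measurable f) (hf : Integrable f Q) :
    ∀ᵐ ω ∂(Measure.infinitePi fun _ : ℕ => Q),
      Tendsto (fun n : ℕ => (∑ i : Fin n, f (ω i)) / n) atTop (𝓝 (∫ x, f x ∂Q)) := by
  have hmp (i : ℕ) : MeasurePreserving (fun ω : ℕ → X => ω i)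
      (Measure.infinitePi fun _ : ℕ => Q) Q := measurePreserving_eval_infinitePi (fun _ => Q) i
  have h := ProbabilityTheory.strong_law_ae_real (μ := Measure.infinitePi fun _ : ℕ => Q)
    (fun i ω => f (ω i)) ((hmp 0).integrable_comp_of_integrable hf)
    (fun i j hij => (ProbabilityTheory.iIndepFun_infinitePi fun _ => hfm).indepFun hij)
    (fun i => ProbabilityTheory.IdentDistrib.comp (u := f)
      ⟨(hmp i).aemeasurable, (hmp 0).aemeasurable, (hmp i).map_eq.trans (hmp 0).map_eq.symm⟩ hfm)
  have hmean : ∫ ω, f (ω 0) ∂(Measure.infinitePi fun _ : ℕ => Q) = ∫ x, f x ∂Q := by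
    rw [← integral_map (hmp 0).aemeasurable hfm.aestronglyMeasurable, (hmp 0).map_eq]
  filter_upwards [h] with ω hω
  rw [← hmean]
  simpa only [Finset.sum_range] using hω

lemma tendsto_pi_of_ae_eventually_mem {E : ∀ n : ℕ, Set (Fin n → X)}
    (hE : ∀ n, MeasurableSet (E n))
    (h : ∀ᵐ ω ∂(Measure.infinitePi fun _ : ℕ => Q), ∀ᶠ n in atTop, (fun i : Fin n => ω i) ∈ E n) :
    Tendsto (fun n => Measure.pi (fun _ : Fin n => Q) (E n)) atTop (𝓝 1) := by
  have hr (n : ℕ) : Measurable fun (ω : ℕ → X) (i : Fin n) => ω i :=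
    measurable_pi_lambda _ fun i => measurable_pi_apply _
  have hmap (n : ℕ) : (Measure.infinitePi fun _ : ℕ => Q).map (fun ω (i : Fin n) => ω i)
      = Measure.pi fun _ : Fin n => Q := by
    rw [Measure.map_infinitePi_infinitePi_of_inj (P := fun _ : ℕ => Q) Fin.val_injective,
      Measure.infinitePi_eq_pi]
  have := tendsto_measure_of_ae_tendsto_indicator_of_isFiniteMeasure atTop MeasurableSet.univ
    (μ := Measure.infinitePi fun _ : ℕ => Q) (fun n => hr n (hE n))
    (h.mono fun ω hω => hω.mono fun n hn => by simpa using hn)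
  rw [measure_univ] at this
  refine this.congr fun n => ?_
  rw [← hmap, Measure.map_apply (hr n) (hE n)]

end ChangeOfMeasure

lemma eventually_exp_le_sampleMeanLaw (P : Measure ℝ) [IsProbabilityMeasure P] {G : Set ℝ}
    (hG : IsOpen G) {Q : Measure ℝ} [IsProbabilityMeasure Q] (hint : Integrable (fun y => y) Q)
    (hmean : ∫ y, y ∂Q ∈ G) (hQP : Q ≪ P) (hllr : Integrable (llr Q P) Q) {r : ℝ}
    (hr : ∫ x, llr Q P x ∂Q < r) :
    ∀ᶠ n : ℕ in atTop, ENNReal.ofReal (Real.exp (-(n * r)) / 2) ≤ sampleMeanLaw P n G := by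
  set E : ∀ n : ℕ, Set (Fin n → ℝ) := fun n => (fun x => (∑ i, x i) / n) ⁻¹' G ∩
    {x | ∏ i, Q.rnDeriv P (x i) ≤ ENNReal.ofReal (Real.exp (n * r))} with hE
  have hEm (n : ℕ) : MeasurableSet (E n) := by
    refine (measurable_sampleMean n hG.measurableSet).inter
      (measurableSet_le (Finset.measurable_fun_prod _ fun i _ => ?_) measurable_const)
    exact (Measure.measurable_rnDeriv Q P).comp (measurable_pi_apply i)
  have hae : ∀ᵐ ω ∂(Measure.infinitePi fun _ : ℕ => Q),
      ∀ᶠ n in atTop, (fun i : Fin n => ω i) ∈ E n := by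
    have hfin : ∀ᵐ ω ∂(Measure.infinitePi fun _ : ℕ => Q), ∀ i : ℕ,
        Q.rnDeriv P (ω i) = ENNReal.ofReal (Real.exp (llr Q P (ω i))) := by
      refine ae_all_iff.2 fun i => ?_
      have hx : ∀ᵐ x ∂Q, Q.rnDeriv P x = ENNReal.ofReal (Real.exp (llr Q P x)) := by
        filter_upwards [Measure.rnDeriv_pos hQP, hQP.ae_le (Measure.rnDeriv_lt_top Q P)]
          with x h₁ h₂
        rw [llr, Real.exp_log (ENNReal.toReal_pos h₁.ne' h₂.ne), ENNReal.ofReal_toReal h₂.ne]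
      exact (measurePreserving_eval_infinitePi (fun _ : ℕ => Q) i).quasiMeasurePreserving.ae hx
    filter_upwards [ae_tendsto_average_infinitePi measurable_id hint,
      ae_tendsto_average_infinitePi (measurable_llr Q P) hllr, hfin] with ω h₁ h₂ h₃
    filter_upwards [h₁.eventually (hG.mem_nhds hmean), h₂.eventually_le_const hr,
      eventually_gt_atTop 0] with n hn₁ hn₂ hn₀
    refine ⟨hn₁, ?_⟩
    change ∏ i : Fin n, Q.rnDeriv P (ω i) ≤ _
    simp_rw [h₃]
    rw [← ENNReal.ofReal_prod_of_nonneg fun i _ => (Real.exp_pos _).le, ← Real.exp_sum]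
    refine ENNReal.ofReal_le_ofReal (Real.exp_le_exp.2 ?_)
    rwa [div_le_iff₀' (by exact_mod_cast hn₀)] at hn₂
  have hhalf : (ENNReal.ofReal (1 / 2)) < 1 := by
    rw [ENNReal.ofReal_lt_one]
    norm_num
  filter_upwards [(tendsto_pi_of_ae_eventually_mem hEm hae).eventually_const_le hhalf] with n hn
  have h := hn.trans (pi_le_mul_pi_of_prod_rnDeriv_le hQP (hEm n) fun x hx => hx.2)
  calc ENNReal.ofReal (Real.exp (-(n * r)) / 2)
      = ENNReal.ofReal (Real.exp (-(n * r))) * ENNReal.ofReal (1 / 2) := by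
        rw [← ENNReal.ofReal_mul (Real.exp_pos _).le, mul_one_div]
    _ ≤ ENNReal.ofReal (Real.exp (-(n * r))) * (ENNReal.ofReal (Real.exp (n * r)) *
          Measure.pi (fun _ : Fin n => P) (E n)) := by gcongr
    _ = Measure.pi (fun _ : Fin n => P) (E n) := by
        rw [← mul_assoc, ← ENNReal.ofReal_mul (Real.exp_pos _).le, ← Real.exp_add]
        simp
    _ ≤ sampleMeanLaw P n G := by
        rw [sampleMeanLaw, Measure.map_apply (measurable_sampleMean n) hG.measurableSet]
        exact measure_mono Set.inter_subset_left

lemma negLogRate_ofReal {n : ℕ} {a : ℝ} (ha : 0 < a) :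
    negLogRate n (ENNReal.ofReal a) = ((-((n : ℝ)⁻¹ * Real.log a) : ℝ) : EReal) := by
  rw [negLogRate, ENNReal.log_ofReal_of_pos ha, ← EReal.coe_neg, ← EReal.coe_mul, neg_mul]

lemma negLogRate_anti (n : ℕ) : Antitone (negLogRate n) := by
  intro p q hpq
  rw [negLogRate, negLogRate, EReal.neg_mul, EReal.neg_mul, EReal.neg_le_neg_iff]
  exact mul_le_mul_of_nonneg_left (ENNReal.log_monotone hpq) (by positivity)

lemma negLogRate_exp_mul {n : ℕ} (hn : n ≠ 0) (r : ℝ) {c : ℝ} (hc : 0 < c) :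
    negLogRate n (ENNReal.ofReal (Real.exp (-(n * r)) * c))
      = ((r - Real.log c / n : ℝ) : EReal) := by
  have hn' : (n : ℝ) ≠ 0 := by exact_mod_cast hn
  rw [negLogRate_ofReal (by positivity), Real.log_mul (Real.exp_pos _).ne' hc.ne', Real.log_exp]
  congr 1
  field_simp
  ring

lemma tendsto_negLogRate_exp_mul (r : ℝ) {c : ℝ} (hc : 0 < c) :
    Tendsto (fun n : ℕ => negLogRate n (ENNReal.ofReal (Real.exp (-(n * r)) * c))) atTop
      (𝓝 (r : EReal)) := by
  have h : Tendsto (fun n : ℕ => r - Real.log c / n) atTop (𝓝 (r - 0)) :=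
    tendsto_const_nhds.sub (tendsto_const_div_atTop_nhds_zero_nat _)
  rw [sub_zero] at h
  refine ((continuous_coe_real_ereal.tendsto r).comp h).congr' ?_
  filter_upwards [eventually_ne_atTop 0] with n hn
  exact (negLogRate_exp_mul hn r hc).symm

/-- Large deviation estimate for closed sets. -/
lemma le_liminf_negLogRate_of_isClosed (P : Measure ℝ) [IsProbabilityMeasure P] {F : Set ℝ}
    (hF : IsClosed F) :
    ((⨅ x ∈ F, cramerRate P x : ℝ≥0∞) : EReal)
      ≤ liminf (fun n : ℕ => negLogRate n (sampleMeanLaw P n F)) atTop := by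
  refine EReal.ge_of_forall_gt_iff_ge.1 fun r hr => ?_
  have hrate : ∀ x ∈ F, ENNReal.ofReal r ≤ cramerRate P x := by
    intro x hx
    refine le_trans ?_ (iInf₂_le (f := fun x _ => cramerRate P x) x hx)
    rcases le_or_gt r 0 with h₀ | h₀
    · simp [ENNReal.ofReal_of_nonpos h₀]
    · rw [← EReal.coe_ennreal_le_coe_ennreal_iff, EReal.coe_ennreal_ofReal, max_eq_left h₀.le]
      exact hr.le
  obtain ⟨L, R, ⟨hL, hLc, hLr⟩, ⟨hR, hRc, hRr⟩, hsub⟩ := exists_convex_cover hF hrate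
  rw [← (tendsto_negLogRate_exp_mul r two_pos).liminf_eq]
  refine liminf_le_liminf ?_
  filter_upwards [eventually_ne_atTop 0] with n hn
  refine negLogRate_anti n ((measure_mono hsub).trans ((measure_union_le _ _).trans ?_))
  rw [mul_two, ENNReal.ofReal_add (Real.exp_pos _).le (Real.exp_pos _).le]
  exact add_le_add (sampleMeanLaw_le_exp_of_convex P hn hL hLc hLr)
    (sampleMeanLaw_le_exp_of_convex P hn hR hRc hRr)

/-- Large deviation estimate for open sets. -/
lemma limsup_negLogRate_le_of_isOpen (P : Measure ℝ) [IsProbabilityMeasure P] {G : Set ℝ}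
    (hG : IsOpen G) :
    limsup (fun n : ℕ => negLogRate n (sampleMeanLaw P n G)) atTop
      ≤ ((⨅ x ∈ G, cramerRate P x : ℝ≥0∞) : EReal) := by
  refine EReal.le_of_forall_lt_iff_le.1 fun r hr => ?_
  have hr₀ : 0 < r := by exact_mod_cast (EReal.coe_ennreal_nonneg _).trans_lt hr
  have hr' : ⨅ x ∈ G, cramerRate P x < ENNReal.ofReal r := by
    rwa [← EReal.coe_ennreal_lt_coe_ennreal_iff, EReal.coe_ennreal_ofReal, max_eq_left hr₀.le]
  obtain ⟨x, hx, hlt⟩ := by simpa only [iInf_lt_iff, exists_prop] using hr'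
  obtain ⟨Q, hQ, hint, rfl, hQr⟩ := exists_relEnt_lt hlt
  rw [relEnt] at hQr
  split_ifs at hQr with h
  · rw [ENNReal.ofReal_lt_ofReal_iff hr₀] at hQr
    have hlim := tendsto_negLogRate_exp_mul r (c := 1 / 2) (by norm_num)
    rw [← hlim.limsup_eq]
    refine limsup_le_limsup ?_
    filter_upwards [eventually_exp_le_sampleMeanLaw P hG hint hx h.1 h.2 hQr] with n hn
    rw [mul_one_div]
    exact negLogRate_anti n hn
  · exact absurd hQr (by simp)

/-- **Cramér's theorem (general version).** The laws of the sample means satisfy the LDP with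
the convex rate function `γ = cramerRate P`: lower bound on closed sets, upper bound on open
sets; in particular the LDP sandwich holds for every Borel set, and `γ` is convex. -/
theorem cramer_general (P : Measure ℝ) [IsProbabilityMeasure P] :
    (∀ F : Set ℝ, IsClosed F →
      ((⨅ x ∈ F, cramerRate P x : ℝ≥0∞) : EReal)
        ≤ liminf (fun n : ℕ => negLogRate n (sampleMeanLaw P n F)) atTop)
    ∧ (∀ G : Set ℝ, IsOpen G →
      limsup (fun n : ℕ => negLogRate n (sampleMeanLaw P n G)) atTop
        ≤ ((⨅ x ∈ G, cramerRate P x : ℝ≥0∞) : EReal))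
    ∧ (∀ Γ : Set ℝ, MeasurableSet Γ →
      ((⨅ x ∈ closure Γ, cramerRate P x : ℝ≥0∞) : EReal)
          ≤ liminf (fun n : ℕ => negLogRate n (sampleMeanLaw P n Γ)) atTop
        ∧ liminf (fun n : ℕ => negLogRate n (sampleMeanLaw P n Γ)) atTop
          ≤ limsup (fun n : ℕ => negLogRate n (sampleMeanLaw P n Γ)) atTop
        ∧ limsup (fun n : ℕ => negLogRate n (sampleMeanLaw P n Γ)) atTop
          ≤ ((⨅ x ∈ interior Γ, cramerRate P x : ℝ≥0∞) : EReal))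
    ∧ (∀ x y : ℝ, ∀ t : ℝ≥0, t ≤ 1 →
      cramerRate P ((t : ℝ) * x + (1 - (t : ℝ)) * y)
        ≤ (t : ℝ≥0∞) * cramerRate P x + ((1 - t : ℝ≥0) : ℝ≥0∞) * cramerRate P y) := by
  refine ⟨fun F hF => le_liminf_negLogRate_of_isClosed P hF,
    fun G hG => limsup_negLogRate_le_of_isOpen P hG, fun Γ _ => ⟨?_, ?_, ?_⟩, ?_⟩
  · refine (le_liminf_negLogRate_of_isClosed P isClosed_closure).trans (liminf_le_liminf ?_)
    exact Eventually.of_forall fun n => negLogRate_anti n (measure_mono subset_closure)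
  · exact liminf_le_limsup
  · refine le_trans (limsup_le_limsup ?_) (limsup_negLogRate_le_of_isOpen P isOpen_interior)
    exact Eventually.of_forall fun n => negLogRate_anti n (measure_mono interior_subset)
  · intro x y t ht
    have h := cramerRate_convexComb_le P x y (add_tsub_cancel_of_le ht)
    rwa [NNReal.coe_sub ht, NNReal.coe_one] at h
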